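/- (Proposition 3, existence and uniqueness part, exchangeable case.) Let δ > ((3 + √5)/2) Ū, let μ₀ be a Borel probability measure on Ω, and let θ : Ω → ℝ be continuous with 0 ≤ θ(x) ≤ Ū for all x ∈ Ω. Then there exists exactly one Borel probability measure m on Ω satisfying m(A) = ∫_A δ / (δ − (θ(x) − ∫_Ω θ dm)) μ₀(dx) for every Borel set A ⊆ Ω; moreover this m is absolutely continuous with respect to μ₀. -/

import Mathlib

open MeasureTheory

/-- The action space `Ω = [0,1] ⊆ ℝ` with its Borel σ-algebra. -/
abbrev Ω : Type := Set.Icc (0:ℝ) 1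


lemma aux_cont (δ : ℝ) (θ : Ω → ℝ) (hθc : Continuous θ) (hθ : ∀ x, θ x < δ) (c : ℝ) (hc : 0 ≤ c) :
    Continuous (fun x => δ / (δ - (θ x - c))) := by
  refine continuous_const.div (by fun_prop) ?_
  intro x
  have := hθ x
  linarith

lemma aux_int (μ0 : Measure Ω) [IsProbabilityMeasure μ0] (f : Ω → ℝ) (hf : Continuous f) :
    Integrable f μ0 := by
  have h := hf.continuousOn.integrableOn_compact (μ := μ0) (isCompact_univ)
  simpa using h

/-- The normalization function is strictly decreasing. -/
lemma aux_lt (U δ : ℝ) (hU : 0 < U) (hδ : U < δ) (μ0 : Measure Ω) [IsProbabilityMeasure μ0]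
    (θ : Ω → ℝ) (hθc : Continuous θ) (hθ : ∀ x, 0 ≤ θ x ∧ θ x ≤ U) (c d : ℝ) (hc : 0 ≤ c)
    (hcd : c < d) :
    ∫ x, δ / (δ - (θ x - d)) ∂μ0 < ∫ x, δ / (δ - (θ x - c)) ∂μ0 := by
  have hlt : ∀ x, θ x < δ := fun x => lt_of_le_of_lt (hθ x).2 hδ
  have i1 := aux_int μ0 _ (aux_cont δ θ hθc hlt c hc)
  have i2 := aux_int μ0 _ (aux_cont δ θ hθc hlt d (by linarith))
  have hpt : ∀ x, δ / (δ - (θ x - d)) < δ / (δ - (θ x - c)) := by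
    intro x
    have := hlt x
    apply div_lt_div_of_pos_left <;> linarith
  rw [← sub_pos, ← integral_sub i1 i2]
  refine (integral_pos_iff_support_of_nonneg
    (f := fun x => δ / (δ - (θ x - c)) - δ / (δ - (θ x - d)))
    (fun x => sub_nonneg.2 (hpt x).le) (i1.sub i2)).2 ?_
  have : Function.support (fun x => δ / (δ - (θ x - c)) - δ / (δ - (θ x - d))) = Set.univ := by
    ext x
    have := hpt x
    simp only [Function.mem_support, Set.mem_univ, iff_true]
    linarith
  rw [this]
  simp

lemma aux_exists (U δ : ℝ) (hU : 0 < U) (hδ : U < δ) (μ0 : Measure Ω) [IsProbabilityMeasure μ0]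
    (θ : Ω → ℝ) (hθc : Continuous θ) (hθ : ∀ x, 0 ≤ θ x ∧ θ x ≤ U) :
    ∃ c, 0 ≤ c ∧ ∫ x, δ / (δ - (θ x - c)) ∂μ0 = 1 := by
  have hlt : ∀ x, θ x < δ := fun x => lt_of_le_of_lt (hθ x).2 hδ
  have hF : Continuous (fun c : ℝ => ∫ x in Set.univ, δ / (δ - (θ x - max c 0)) ∂μ0) := by
    apply continuous_parametric_integral_of_continuous _ isCompact_univ
    refine continuous_const.div (by fun_prop) ?_
    rintro ⟨c, x⟩
    have := hlt x
    have := le_max_right c 0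
    simp only
    linarith
  simp only [setIntegral_univ] at hF
  have h0 : (1:ℝ) ≤ ∫ x, δ / (δ - (θ x - max 0 0)) ∂μ0 := by
    have := integral_mono (integrable_const (μ := μ0) (1:ℝ))
      (aux_int μ0 _ (aux_cont δ θ hθc hlt (max 0 0) (by simp))) (by
        intro x
        have := hlt x
        have := hθ x
        simp only [max_self]
        rw [le_div_iff₀ (by linarith)]
        linarith)
    simpa using this
  have h1 : ∫ x, δ / (δ - (θ x - max U 0)) ∂μ0 ≤ 1 := by
    have := integral_mono (aux_int μ0 _ (aux_cont δ θ hθc hlt (max U 0) (by simp)))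
      (integrable_const (μ := μ0) (1:ℝ)) (by
        intro x
        have := hlt x
        have := hθ x
        simp only [max_eq_left hU.le]
        rw [div_le_iff₀ (by linarith)]
        linarith)
    simpa using this
  obtain ⟨c, hc, h⟩ := intermediate_value_Icc' hU.le hF.continuousOn ⟨h1, h0⟩
  refine ⟨c, hc.1, ?_⟩
  simpa only [max_eq_left hc.1] using h

/-- **Proposition 3, existence and uniqueness part (exchangeable case).**
For `δ > ((3+√5)/2)Ū` there is exactly one Borel probability measure `m` with
`m(A) = ∫_A δ / (δ − (θ(x) − ∫ θ dm)) μ₀(dx)` for all Borel `A`; moreover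
this `m` is absolutely continuous with respect to `μ₀`. -/
theorem stmt6
    (Ubar : ℝ) (hUbar : 0 < Ubar)
    (δ : ℝ) (hδ : (3 + Real.sqrt 5) / 2 * Ubar < δ)
    (μ0 : Measure Ω) [IsProbabilityMeasure μ0]
    (θ : Ω → ℝ) (hθc : Continuous θ) (hθ : ∀ x, 0 ≤ θ x ∧ θ x ≤ Ubar) :
    (∃! m : Measure Ω, IsProbabilityMeasure m ∧
      ∀ A : Set Ω, MeasurableSet A →
        m A = ENNReal.ofReal (∫ x in A, δ / (δ - (θ x - ∫ z, θ z ∂m)) ∂μ0)) ∧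
    (∀ m : Measure Ω, IsProbabilityMeasure m →
      (∀ A : Set Ω, MeasurableSet A →
        m A = ENNReal.ofReal (∫ x in A, δ / (δ - (θ x - ∫ z, θ z ∂m)) ∂μ0)) →
      m ≪ μ0) := by
  have hδU : Ubar < δ := by
    have := Real.sqrt_nonneg 5
    nlinarith
  have hδ0 : 0 < δ := by linarith
  have hlt : ∀ x, θ x < δ := fun x => lt_of_le_of_lt (hθ x).2 hδU
  constructor
  · obtain ⟨c, hc0, hc⟩ := aux_exists Ubar δ hUbar hδU μ0 θ hθc hθ
    have gc := aux_cont δ θ hθc hlt c hc0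
    have gpos : ∀ x, 0 ≤ δ / (δ - (θ x - c)) := fun x => by
      have := hlt x
      exact div_nonneg hδ0.le (by linarith)
    have gi := aux_int μ0 _ gc
    have hm : ∀ A : Set Ω, MeasurableSet A →
        (μ0.withDensity (fun x => ENNReal.ofReal (δ / (δ - (θ x - c))))) A
          = ENNReal.ofReal (∫ x in A, δ / (δ - (θ x - c)) ∂μ0) := by
      intro A hA
      rw [withDensity_apply _ hA, ofReal_integral_eq_lintegral_ofReal gi.integrableOn
        (Filter.Eventually.of_forall gpos)]
    have hint : ∫ z, θ z ∂(μ0.withDensity (fun x => ENNReal.ofReal (δ / (δ - (θ x - c))))) = c := by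
      rw [integral_withDensity_eq_integral_toReal_smul (by fun_prop)
        (Filter.Eventually.of_forall fun x => ENNReal.ofReal_lt_top)]
      have : ∀ x, (ENNReal.ofReal (δ / (δ - (θ x - c)))).toReal • θ x
          = (δ + c) * (δ / (δ - (θ x - c))) - δ := by
        intro x
        rw [ENNReal.toReal_ofReal (gpos x), smul_eq_mul]
        have : δ - (θ x - c) ≠ 0 := by
          have := hlt x
          linarith
        field_simp
        ring
      simp_rw [this]
      rw [integral_sub (gi.const_mul _) (integrable_const _), integral_const_mul, hc]
      simp
    refine ⟨μ0.withDensity (fun x => ENNReal.ofReal (δ / (δ - (θ x - c)))), ⟨⟨?_⟩, ?_⟩, ?_⟩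
    · rw [hm _ MeasurableSet.univ, setIntegral_univ, hc]
      simp
    · intro A hA
      rw [hint]
      exact hm A hA
    · rintro m ⟨hmp, h⟩
      have hd0 : 0 ≤ ∫ z, θ z ∂m := integral_nonneg fun x => (hθ x).1
      have h1 := h _ MeasurableSet.univ
      rw [measure_univ, setIntegral_univ, eq_comm, ENNReal.ofReal_eq_one] at h1
      have hcd : ∫ z, θ z ∂m = c := by
        rcases lt_trichotomy (∫ z, θ z ∂m) c with hl | hl | hl
        · have := aux_lt Ubar δ hUbar hδU μ0 θ hθc hθ _ _ hd0 hl
          linarith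
        · exact hl
        · have := aux_lt Ubar δ hUbar hδU μ0 θ hθc hθ _ _ hc0 hl
          linarith
      ext A hA
      rw [h A hA, hcd, hm A hA]
  · intro m _ h
    refine Measure.AbsolutelyContinuous.mk fun A hA h0 => ?_
    rw [h A hA, setIntegral_measure_zero _ h0]
    simp
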